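/- An element a ∈ I₁ admits a left inverse in I₁ (i.e., ba = 1 for some b ∈ I₁) if and only if a = u∫^n for some unit u of the ring I₁ and some integer n ≥ 0; in that case n = dim_K coker(a_{K[x]}). Dually, an element b ∈ I₁ admits a right inverse in I₁ if and only if b = ∂^n u for some unit u of I₁ and some integer n ≥ 0; in that case n = dim_K ker(b_{K[x]}). -/

import Mathlib

open Polynomial

noncomputable section
set_option synthInstance.maxHeartbeats 1000000
set_option maxHeartbeats 1000000
set_option linter.unusedSectionVars false

variable (K : Type*) [Field K] [CharZero K]

/-- The derivative operator `∂ = d/dx` on `K[x]`. -/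
def derOp : Module.End K (Polynomial K) := Polynomial.derivative

/-- The multiplication-by-`x` operator on `K[x]`. -/
def xOp : Module.End K (Polynomial K) := LinearMap.mulLeft K Polynomial.X

/-- The integration operator `∫`, determined by `∫ xⁿ = xⁿ⁺¹/(n+1)`. -/
def intOp : Module.End K (Polynomial K) :=
  (Polynomial.basisMonomials K).constr K fun n => ((n : K) + 1)⁻¹ • X ^ (n + 1)

/-- The algebra `I₁` of polynomial integro-differential operators: the subalgebra of
`End_K(K[x])` generated by `x`, `∂` and `∫`. -/
def I1 : Subalgebra K (Module.End K (Polynomial K)) :=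
  Algebra.adjoin K {xOp K, derOp K, intOp K}

/-- `e_{ij} := ∫^i ∂^j − ∫^{i+1} ∂^{j+1}`. -/
def eOp (i j : ℕ) : Module.End K (Polynomial K) :=
  intOp K ^ i * derOp K ^ j - intOp K ^ (i + 1) * derOp K ^ (j + 1)

/-- `F`, the `K`-linear span of the `e_{ij}`; it is the (two-sided) ideal of compact
operators of `I₁`. -/
def Fset : Submodule K (Module.End K (Polynomial K)) :=
  Submodule.span K {f | ∃ i j, f = eOp K i j}

lemma xOp_mem : xOp K ∈ I1 K := Algebra.subset_adjoin (by simp)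
lemma derOp_mem : derOp K ∈ I1 K := Algebra.subset_adjoin (by simp)
lemma intOp_mem : intOp K ∈ I1 K := Algebra.subset_adjoin (by simp)

lemma eOp_mem (i j : ℕ) : eOp K i j ∈ I1 K :=
  sub_mem (mul_mem (pow_mem (intOp_mem K) i) (pow_mem (derOp_mem K) j))
    (mul_mem (pow_mem (intOp_mem K) (i + 1)) (pow_mem (derOp_mem K) (j + 1)))

/-- `e_{ij}` as an element of the ring `I₁`. -/
def eI (i j : ℕ) : I1 K := ⟨eOp K i j, eOp_mem K i j⟩

/-- `∂` as an element of the ring `I₁`. -/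
def derI : I1 K := ⟨derOp K, derOp_mem K⟩

/-- `∫` as an element of the ring `I₁`. -/
def intI : I1 K := ⟨intOp K, intOp_mem K⟩

/-- `H := ∂ ∘ x` (first multiply by `x`, then differentiate). -/
def hOp : Module.End K (Polynomial K) := derOp K * xOp K

/-- `K[H]`, the unital subalgebra of `I₁` generated by `H`. -/
def KH : Subalgebra K (Module.End K (Polynomial K)) := Algebra.adjoin K {hOp K}

/-- The action of `a ∈ I₁` on a left `I₁`-module `M`, as a `K`-linear map `a_M : M → M`. -/
def actMap (a : I1 K) (M : Type*) [AddCommGroup M] [Module (I1 K) M] [Module K M]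
    [SMulCommClass K (I1 K) M] : M →ₗ[K] M where
  toFun m := a • m
  map_add' := smul_add a
  map_smul' k m := (smul_comm k a m).symm

/-- Right multiplication `b ↦ b * a` in a ring `R`, as a homomorphism of left `R`-modules. -/
def rmulMap (R : Type*) [Ring R] (a : R) : R →ₗ[R] R where
  toFun b := b * a
  map_add' b c := add_mul b c a
  map_smul' c b := by simp [smul_eq_mul, mul_assoc]

/-- Left multiplication `b ↦ a * b` in a ring `R`, as a homomorphism of right `R`-modules
(i.e. of left `Rᵐᵒᵖ`-modules). -/
def lmulMap (R : Type*) [Ring R] (a : R) : R →ₗ[Rᵐᵒᵖ] R where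
  toFun b := a * b
  map_add' b c := mul_add a b c
  map_smul' c b := by simp [MulOpposite.smul_eq_mul_unop, mul_assoc]

/-- The centralizer `Cen_{I₁}(a) = {b ∈ I₁ : ab = ba}` of `a` in `I₁`, as a subalgebra of
`End_K(K[x])`. -/
def Cen (a : Module.End K (Polynomial K)) : Subalgebra K (Module.End K (Polynomial K)) :=
  I1 K ⊓ Subalgebra.centralizer K {a}

/-- `Cen_F(a) = {f ∈ F : af = fa}`, a `K`-subspace of `End_K(K[x])`. -/
def CenF (a : Module.End K (Polynomial K)) : Submodule K (Module.End K (Polynomial K)) :=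
  Fset K ⊓ Subalgebra.toSubmodule (Subalgebra.centralizer K {a})


/-- The divided power `x ^ k / k!`. -/
def divPow (k : ℕ) : Polynomial K := monomial k ((k.factorial : K)⁻¹)

lemma factorial_smul_divPow (k : ℕ) : (k.factorial : K) • divPow K k = monomial k 1 := by
  have h : (k.factorial : K) ≠ 0 := by exact_mod_cast k.factorial_ne_zero
  simp [divPow, smul_monomial, h]

lemma end_ext_divPow {f g : Module.End K (Polynomial K)}
    (h : ∀ k, f (divPow K k) = g (divPow K k)) : f = g := by
  refine (Polynomial.basisMonomials K).ext fun k => ?_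
  simp only [coe_basisMonomials, ← factorial_smul_divPow, map_smul, h]

lemma derOp_divPow_zero : derOp K (divPow K 0) = 0 := by
  simp [derOp, divPow]

lemma derOp_divPow_succ (k : ℕ) : derOp K (divPow K (k + 1)) = divPow K k := by
  have h : (k.factorial : K) ≠ 0 := by exact_mod_cast k.factorial_ne_zero
  have h' : (k : K) + 1 ≠ 0 := by exact_mod_cast k.succ_ne_zero
  simp only [derOp, divPow, derivative_monomial, Nat.factorial_succ, Nat.add_sub_cancel]
  congr 1
  push_cast
  field_simp

lemma intOp_divPow (k : ℕ) : intOp K (divPow K k) = divPow K (k + 1) := by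
  have hm : divPow K k = (k.factorial : K)⁻¹ • Polynomial.basisMonomials K k := by
    simp [divPow, smul_monomial]
  rw [hm, map_smul, intOp, Module.Basis.constr_basis]
  simp only [divPow, ← monomial_one_right_eq_X_pow, smul_monomial, Nat.factorial_succ]
  congr 1
  push_cast
  simp [mul_comm]

lemma xOp_divPow (k : ℕ) :
    xOp K (divPow K k) = ((k : K) + 1) • divPow K (k + 1) := by
  have h : (k.factorial : K) ≠ 0 := by exact_mod_cast k.factorial_ne_zero
  have h' : (k : K) + 1 ≠ 0 := by exact_mod_cast k.succ_ne_zero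
  simp only [xOp, divPow, LinearMap.mulLeft_apply, X_mul_monomial, smul_monomial,
    Nat.factorial_succ]
  congr 1
  push_cast
  rw [smul_eq_mul, mul_inv, mul_inv_cancel_left₀ h']

lemma intOp_pow_divPow (n k : ℕ) : (intOp K ^ n) (divPow K k) = divPow K (k + n) := by
  induction n with
  | zero => simp
  | succ n ih => rw [pow_succ', Module.End.mul_apply, ih, intOp_divPow]; rfl

lemma derOp_pow_divPow (n k : ℕ) : (derOp K ^ n) (divPow K (k + n)) = divPow K k := by
  induction n with
  | zero => simp
  | succ n ih => rw [pow_succ, Module.End.mul_apply, ← add_assoc, derOp_divPow_succ, ih]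

lemma derOp_pow_divPow_of_lt {n k : ℕ} (h : k < n) : (derOp K ^ n) (divPow K k) = 0 := by
  obtain ⟨d, rfl⟩ := Nat.exists_eq_add_of_lt h
  have h1 := derOp_pow_divPow K k 0
  rw [zero_add] at h1
  rw [show k + d + 1 = d + 1 + k by ring, pow_add, Module.End.mul_apply, h1, pow_succ,
    Module.End.mul_apply, derOp_divPow_zero, map_zero]

lemma derOp_pow_mul_intOp_pow (n : ℕ) : derOp K ^ n * intOp K ^ n = 1 :=
  end_ext_divPow K fun k => by
    rw [Module.End.mul_apply, intOp_pow_divPow, derOp_pow_divPow, Module.End.one_apply]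

lemma eOp_zero_divPow (j k : ℕ) : eOp K 0 j (divPow K k) = if j = k then 1 else 0 := by
  simp only [eOp, pow_zero, one_mul, zero_add, pow_one, LinearMap.sub_apply, Module.End.mul_apply]
  rcases lt_trichotomy k j with h | rfl | h
  · rw [derOp_pow_divPow_of_lt K h, derOp_pow_divPow_of_lt K (h.trans j.lt_succ_self), if_neg h.ne']
    simp
  · have h1 := derOp_pow_divPow K k 0
    rw [zero_add] at h1
    rw [h1, derOp_pow_divPow_of_lt K k.lt_succ_self, if_pos rfl]
    simp [divPow]
  · obtain ⟨d, rfl⟩ := Nat.exists_eq_add_of_lt h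
    rw [if_neg h.ne, show j + d + 1 = (d + 1) + j by ring, derOp_pow_divPow,
      show d + 1 + j = d + (j + 1) by ring, derOp_pow_divPow, intOp_divPow, sub_self]

lemma aeval_xOp_apply_one (h : Polynomial K) : aeval (xOp K) h 1 = h := by
  induction h using Polynomial.induction_on' with
  | add p q hp hq => rw [map_add, LinearMap.add_apply, hp, hq]
  | monomial n c =>
    have : ∀ n : ℕ, (xOp K ^ n) 1 = X ^ n := fun n => by
      induction n with
      | zero => simp
      | succ n ih => rw [pow_succ', Module.End.mul_apply, ih, pow_succ']; rfl
    rw [aeval_monomial, Module.End.mul_apply, this, Module.algebraMap_end_apply,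
      smul_X_eq_monomial]

/-- An operator that vanishes on all sufficiently high powers of `x` lies in `I₁`. -/
lemma mem_I1_of_divPow_eq_zero {f : Module.End K (Polynomial K)} {m : ℕ}
    (hf : ∀ k, m ≤ k → f (divPow K k) = 0) : f ∈ I1 K := by
  have h : f = ∑ j ∈ Finset.range m, aeval (xOp K) (f (divPow K j)) * eOp K 0 j := by
    refine end_ext_divPow K fun k => ?_
    simp only [LinearMap.sum_apply, Module.End.mul_apply, eOp_zero_divPow]
    rcases lt_or_ge k m with hk | hk
    · rw [Finset.sum_eq_single k (fun j _ hj => by simp [hj])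
        (fun h => absurd (Finset.mem_range.2 hk) h), if_pos rfl, aeval_xOp_apply_one]
    · rw [hf k hk, Finset.sum_eq_zero]
      intro j hj
      rw [if_neg ((Finset.mem_range.1 hj).trans_le hk).ne, map_zero]
  rw [h]
  refine sum_mem fun j _ => mul_mem ?_ (eOp_mem K 0 j)
  exact Algebra.adjoin_mono (by simp) (aeval_mem_adjoin_singleton K (xOp K))

/-- The operators which act on all sufficiently high divided powers of `x` as a polynomial in `∫`
whose coefficients depend polynomially on the exponent. -/
def HasSymbol (s : Module.End K (Polynomial K)) : Prop :=
  ∃ (D : ℕ) (P : Polynomial (Polynomial K)), ∀ k : ℕ,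
    s (divPow K (k + D)) = aeval (intOp K) (P.map (evalRingHom (k : K))) (divPow K k)

/-- The coefficients shifted by one in the exponent, times `∫`. -/
def shiftSymbol (P : Polynomial (Polynomial K)) : Polynomial (Polynomial K) :=
  P.map (compRingHom (X + 1)) * X

lemma aeval_shiftSymbol (P : Polynomial (Polynomial K)) (k : ℕ) :
    aeval (intOp K) ((shiftSymbol K P).map (evalRingHom (k : K))) (divPow K k) =
      aeval (intOp K) (P.map (evalRingHom ((k + 1 : ℕ) : K))) (divPow K (k + 1)) := by
  have h : (evalRingHom (k : K)).comp (compRingHom (X + 1)) = evalRingHom ((k + 1 : ℕ) : K) := by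
    ext <;> simp
  rw [shiftSymbol, Polynomial.map_mul, map_X, map_mul, aeval_X, Module.End.mul_apply,
    intOp_divPow, Polynomial.map_map, h]

variable {K}

lemma HasSymbol.exists_of_le {s : Module.End K (Polynomial K)} {D E : ℕ} (hDE : D ≤ E)
    {P : Polynomial (Polynomial K)} (h : ∀ k : ℕ,
      s (divPow K (k + D)) = aeval (intOp K) (P.map (evalRingHom (k : K))) (divPow K k)) :
    ∃ Q : Polynomial (Polynomial K), ∀ k : ℕ,
      s (divPow K (k + E)) = aeval (intOp K) (Q.map (evalRingHom (k : K))) (divPow K k) := by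
  induction E, hDE using Nat.le_induction with
  | base => exact ⟨P, h⟩
  | succ E _ ih =>
    obtain ⟨Q, hQ⟩ := ih
    refine ⟨shiftSymbol K Q, fun k => ?_⟩
    rw [aeval_shiftSymbol, ← hQ, show k + (E + 1) = k + 1 + E by ring]

lemma HasSymbol.add {s t : Module.End K (Polynomial K)} (hs : HasSymbol K s)
    (ht : HasSymbol K t) : HasSymbol K (s + t) := by
  obtain ⟨D, P, hP⟩ := hs
  obtain ⟨E, Q, hQ⟩ := ht
  obtain ⟨P', hP'⟩ := HasSymbol.exists_of_le (le_max_left D E) hP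
  obtain ⟨Q', hQ'⟩ := HasSymbol.exists_of_le (le_max_right D E) hQ
  refine ⟨max D E, P' + Q', fun k => ?_⟩
  rw [LinearMap.add_apply, hP', hQ', Polynomial.map_add, map_add, LinearMap.add_apply]

lemma HasSymbol.mul_of_mem {t : Module.End K (Polynomial K)} (ht : t ∈ I1 K) :
    ∀ s, HasSymbol K s → HasSymbol K (s * t) := by
  induction ht using Algebra.adjoin_induction with
  | mem t ht =>
    rintro s ⟨D, P, h⟩
    rcases ht with rfl | rfl | rfl
    · refine ⟨D, C (X + C ((D : K) + 1)) * shiftSymbol K P, fun k => ?_⟩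
      rw [Module.End.mul_apply, xOp_divPow, map_smul, Polynomial.map_mul, map_C, map_mul, aeval_C,
        Module.End.mul_apply, aeval_shiftSymbol, ← h, Module.algebraMap_end_apply,
        show k + D + 1 = k + 1 + D by ring]
      simp [add_assoc]
    · refine ⟨D + 1, P, fun k => ?_⟩
      rw [Module.End.mul_apply, ← add_assoc, derOp_divPow_succ, h]
    · refine ⟨D, shiftSymbol K P, fun k => ?_⟩
      rw [Module.End.mul_apply, intOp_divPow, aeval_shiftSymbol, ← h,
        show k + D + 1 = k + 1 + D by ring]
  | algebraMap r =>
    rintro s ⟨D, P, h⟩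
    refine ⟨D, C (C r) * P, fun k => ?_⟩
    rw [Module.End.mul_apply, Module.algebraMap_end_apply, map_smul, h, Polynomial.map_mul, map_C,
      map_mul, aeval_C, Module.End.mul_apply, Module.algebraMap_end_apply]
    simp
  | add t t' _ _ iht iht' =>
    intro s hs
    rw [mul_add]
    exact (iht s hs).add (iht' s hs)
  | mul t t' _ _ iht iht' =>
    intro s hs
    rw [← mul_assoc]
    exact iht' _ (iht s hs)

lemma hasSymbol_of_mem {s : Module.End K (Polynomial K)} (hs : s ∈ I1 K) : HasSymbol K s := by
  simpa using HasSymbol.mul_of_mem hs 1 ⟨0, 1, fun k => by simp⟩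

lemma natDegree_divPow_le (k : ℕ) : (divPow K k).natDegree ≤ k := natDegree_monomial_le _

lemma aeval_intOp_divPow {q : Polynomial K} {m : ℕ} (hq : q.natDegree ≤ m) (k : ℕ) :
    aeval (intOp K) q (divPow K k) = ∑ i ∈ Finset.range (m + 1), q.coeff i • divPow K (k + i) := by
  rw [aeval_eq_sum_range' (Nat.lt_succ_of_le hq)]
  simp [LinearMap.sum_apply, intOp_pow_divPow]

lemma coeff_aeval_intOp_divPow {q : Polynomial K} {m : ℕ} (hq : q.natDegree ≤ m) (k : ℕ) :
    (aeval (intOp K) q (divPow K k)).coeff (k + m) =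
      q.coeff m * (((k + m).factorial : K)⁻¹) := by
  rw [aeval_intOp_divPow hq, finsetSum_coeff, Finset.sum_eq_single m]
  · simp [divPow]
  · intro i _ hi
    simp [divPow, coeff_monomial, hi]
  · simp

lemma natDegree_aeval_intOp_divPow {q : Polynomial K} {m : ℕ} (hq : q.natDegree ≤ m) (k : ℕ) :
    (aeval (intOp K) q (divPow K k)).natDegree ≤ k + m := by
  rw [aeval_intOp_divPow hq]
  refine natDegree_sum_le_of_forall_le _ _ fun i hi => ?_
  exact (natDegree_smul_le _ _).trans ((natDegree_divPow_le _).trans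
    (by have := Finset.mem_range.1 hi; omega))

/-- An element of `I₁` either vanishes on all sufficiently high powers of `x`, or is nonzero on
all polynomials of sufficiently high degree. -/
lemma eventually_zero_or_ne_zero {s : Module.End K (Polynomial K)} (hs : s ∈ I1 K) :
    (∃ m, ∀ k, m ≤ k → s (divPow K k) = 0) ∨ ∃ N, ∀ f, N ≤ f.natDegree → s f ≠ 0 := by
  obtain ⟨D, P, h⟩ := hasSymbol_of_mem hs
  by_cases hP : P = 0
  · refine Or.inl ⟨D, fun k hk => ?_⟩
    obtain ⟨d, rfl⟩ := Nat.exists_eq_add_of_le' hk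
    simp [h, hP]
  right
  have hroots : {k : ℕ | P.leadingCoeff.eval (k : K) = 0}.Finite :=
    (P.leadingCoeff.rootSet_finite K).preimage Nat.cast_injective.injOn |>.subset fun k hk => by
      simpa [mem_rootSet, hP] using hk
  obtain ⟨B, hB⟩ := hroots.bddAbove
  set M := (Finset.range D).sup fun j => (s (divPow K j)).natDegree
  have hdeg : ∀ k : ℕ, (P.map (evalRingHom (k : K))).natDegree ≤ P.natDegree :=
    fun k => natDegree_map_le
  have low : ∀ n k : ℕ, M ≤ n → k < n + D + 1 →
      (s (divPow K k)).coeff (n + 1 + P.natDegree) = 0 := by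
    intro n k hn hk
    refine coeff_eq_zero_of_natDegree_lt ?_
    rcases lt_or_ge k D with hkD | hkD
    · have : (s (divPow K k)).natDegree ≤ M :=
        Finset.le_sup (f := fun j => (s (divPow K j)).natDegree) (Finset.mem_range.2 hkD)
      omega
    · obtain ⟨d, rfl⟩ := Nat.exists_eq_add_of_le' hkD
      rw [h]
      have := natDegree_aeval_intOp_divPow (hdeg d) d
      omega
  refine ⟨M + B + D + 1, fun f hf hsf => ?_⟩
  obtain ⟨n, hn⟩ : ∃ n, f.natDegree = n + 1 + D := ⟨f.natDegree - D - 1, by omega⟩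
  have hf0 : f ≠ 0 := by rintro rfl; simp at hn; omega
  have key : (s f).coeff (n + 1 + P.natDegree) = f.leadingCoeff * ((n + 1 + D).factorial : K) *
      (P.leadingCoeff.eval ((n + 1 : ℕ) : K) * ((n + 1 + P.natDegree).factorial : K)⁻¹) := by
    have hsum : s f = ∑ i ∈ Finset.range (n + 1 + D + 1),
        (f.coeff i * (i.factorial : K)) • s (divPow K i) := by
      conv_lhs => rw [f.as_sum_range, map_sum, hn]
      refine Finset.sum_congr rfl fun i _ => ?_
      rw [← map_smul, mul_smul, factorial_smul_divPow, smul_monomial, smul_eq_mul, mul_one]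
    rw [hsum, Finset.sum_range_succ, coeff_add, finsetSum_coeff, Finset.sum_eq_zero, zero_add,
      coeff_smul, h, coeff_aeval_intOp_divPow (hdeg _), leadingCoeff, hn, coeff_map,
      smul_eq_mul]
    · rfl
    · intro i hi
      rw [coeff_smul, low n i (by omega) (by have := Finset.mem_range.1 hi; omega), smul_zero]
  rw [hsf, coeff_zero, eq_comm] at key
  have h1 : P.leadingCoeff.eval ((n + 1 : ℕ) : K) ≠ 0 := fun h0 => by
    have := hB h0
    omega
  refine mul_ne_zero (mul_ne_zero (leadingCoeff_ne_zero.2 hf0) ?_) (mul_ne_zero h1 ?_) key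
  · exact_mod_cast Nat.factorial_ne_zero _
  · exact inv_ne_zero (by exact_mod_cast Nat.factorial_ne_zero _)

variable (K)

lemma ker_derOp_pow (n : ℕ) : LinearMap.ker (derOp K ^ n) = degreeLT K n := by
  ext f
  rw [LinearMap.mem_ker, mem_degreeLT, Module.End.pow_apply]
  change derivative^[n] f = 0 ↔ _
  rw [degree_lt_iff_coeff_zero]
  constructor
  · intro h k hk
    obtain ⟨d, rfl⟩ := Nat.exists_eq_add_of_le' hk
    have := congrArg (fun p => coeff p d) h
    simpa [coeff_iterate_derivative, Nat.descFactorial_eq_zero_iff_lt] using this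
  · intro h
    ext d
    rw [coeff_iterate_derivative, h _ (by omega), smul_zero, coeff_zero]

instance finiteDimensional_ker_derOp_pow (n : ℕ) :
    FiniteDimensional K (LinearMap.ker (derOp K ^ n)) := by
  rw [ker_derOp_pow]
  exact Module.Finite.equiv (degreeLTEquiv K n).symm

lemma finrank_ker_derOp_pow (n : ℕ) : Module.finrank K (LinearMap.ker (derOp K ^ n)) = n := by
  rw [ker_derOp_pow, (degreeLTEquiv K n).finrank_eq, Module.finrank_fin_fun]

/-- The projection `1 - ∫ ^ n ∂ ^ n` of `K[x]` onto `ker ∂ ^ n`. -/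
def kerProj (n : ℕ) : Polynomial K →ₗ[K] LinearMap.ker (derOp K ^ n) :=
  LinearMap.codRestrict _ (1 - intOp K ^ n * derOp K ^ n) fun f => by
    rw [LinearMap.mem_ker, ← Module.End.mul_apply, mul_sub, ← mul_assoc,
      derOp_pow_mul_intOp_pow, one_mul, mul_one, sub_self, LinearMap.zero_apply]

lemma coe_kerProj (n : ℕ) (f : Polynomial K) :
    (kerProj K n f : Polynomial K) = f - (intOp K ^ n) ((derOp K ^ n) f) := rfl

lemma kerProj_coe (n : ℕ) (f : LinearMap.ker (derOp K ^ n)) : kerProj K n f = f := by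
  ext1
  rw [coe_kerProj, LinearMap.mem_ker.1 f.2, map_zero, sub_zero]

lemma kerProj_intOp_pow (n : ℕ) (f : Polynomial K) : kerProj K n ((intOp K ^ n) f) = 0 := by
  ext1
  rw [coe_kerProj, ← Module.End.mul_apply (derOp K ^ n), derOp_pow_mul_intOp_pow]
  exact sub_self _

lemma kerProj_divPow {n k : ℕ} (h : n ≤ k) : kerProj K n (divPow K k) = 0 := by
  obtain ⟨d, rfl⟩ := Nat.exists_eq_add_of_le' h
  rw [← intOp_pow_divPow, kerProj_intOp_pow]

lemma derI_pow_mul_intI_pow (n : ℕ) : derI K ^ n * intI K ^ n = 1 :=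
  Subtype.ext (derOp_pow_mul_intOp_pow K n)

variable {K}

section Ring

variable {R : Type*} [Ring R] {a c : R}

lemma one_sub_mul_mul_self (h : c * a = 1) : (1 - a * c) * a = 0 := by
  rw [sub_mul, mul_assoc, h, one_mul, mul_one, sub_self]

lemma mul_one_sub_mul_self (h : c * a = 1) : c * (1 - a * c) = 0 := by
  rw [mul_sub, ← mul_assoc, h, one_mul, mul_one, sub_self]

lemma one_sub_mul_mul_one_sub_mul (h : c * a = 1) : (1 - a * c) * (1 - a * c) = 1 - a * c := by
  rw [sub_mul, mul_assoc, mul_one_sub_mul_self h, one_mul, mul_zero, sub_zero]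

/-- If `b u` is a left inverse of `i` with `u` a unit, and `d` is another left inverse of `i`,
then `b` and `d` differ by a unit factor on the right. -/
lemma exists_eq_mul_unit {b d i : R} (u : Rˣ) (hb : b * (↑u * i) = 1) (hd : d * i = 1) :
    ∃ w : Rˣ, b = d * ↑w := by
  set f := b * ↑u - d with hf
  have hfi : f * i = 0 := by rw [hf, sub_mul, mul_assoc, hb, hd, sub_self]
  have hsq : i * f * (i * f) = 0 := by rw [mul_assoc, ← mul_assoc f, hfi, zero_mul, mul_zero]
  let w : Rˣ := ⟨1 + i * f, 1 - i * f,
    by rw [add_mul, mul_sub, mul_sub (i * f), hsq]; simp,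
    by rw [sub_mul, mul_add, mul_add, hsq]; simp⟩
  refine ⟨w * u⁻¹, ?_⟩
  rw [Units.val_mul, ← mul_assoc, Units.eq_mul_inv_iff_mul_eq]
  change b * ↑u = d * (1 + i * f)
  rw [mul_add, ← mul_assoc, hd, hf, mul_one, one_mul, add_sub_cancel]

end Ring

lemma one_sub_mul_eventually_zero {a c : I1 K} (h : c * a = 1) :
    ∃ m, ∀ k, m ≤ k → (1 - a * c : I1 K).1 (divPow K k) = 0 := by
  refine (eventually_zero_or_ne_zero (1 - a * c : I1 K).2).resolve_right ?_
  rintro ⟨N, hN⟩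
  have hpa : (1 - a * c : I1 K) * a = 0 := one_sub_mul_mul_self (R := I1 K) h
  have hca : ∀ f, c.1 (a.1 f) = f := fun f => LinearMap.congr_fun (congrArg Subtype.val h) f
  have hlt : ∀ f, a.1 f ∈ degreeLT K N := fun f => by
    by_contra hf
    refine hN (a.1 f) ?_ (LinearMap.congr_fun (congrArg Subtype.val hpa) f)
    by_contra hlt
    exact hf (mem_degreeLT.2 (degree_le_natDegree.trans_lt (by exact_mod_cast not_le.1 hlt)))
  have : FiniteDimensional K (degreeLT K N) := Module.Finite.equiv (degreeLTEquiv K N).symm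
  have hfin : FiniteDimensional K (Polynomial K) :=
    FiniteDimensional.of_injective (LinearMap.codRestrict (degreeLT K N) a.1 hlt)
      fun f g hfg => by
        rw [← hca f, ← hca g]
        exact congrArg (fun y : degreeLT K N => c.1 y.1) hfg
  exact Polynomial.not_finite hfin

lemma exists_unit_mul_intI_pow {a c : I1 K} (h : c * a = 1) :
    ∃ (u : (I1 K)ˣ) (n : ℕ), a = ↑u * intI K ^ n := by
  obtain ⟨m, hm⟩ := one_sub_mul_eventually_zero h
  set p : I1 K := 1 - a * c with hp
  have hpa : p * a = 0 := one_sub_mul_mul_self (R := I1 K) h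
  have hcp : c * p = 0 := mul_one_sub_mul_self (R := I1 K) h
  have hpp : p * p = p := one_sub_mul_mul_one_sub_mul (R := I1 K) h
  set V := LinearMap.range p.1 with hV
  have hVfin : FiniteDimensional K V := by
    have hle : V ≤ (LinearMap.ker (derOp K ^ m)).map p.1 := by
      rintro _ ⟨f, rfl⟩
      refine ⟨kerProj K m f, (kerProj K m f).2, ?_⟩
      have : p.1 * intOp K ^ m = 0 := end_ext_divPow K fun k => by
        rw [Module.End.mul_apply, intOp_pow_divPow, hm _ (by omega), LinearMap.zero_apply]
      rw [coe_kerProj, map_sub, ← Module.End.mul_apply, this, LinearMap.zero_apply, sub_zero]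
    exact Submodule.finiteDimensional_of_le hle
  set n := Module.finrank K V with hn
  let e : LinearMap.ker (derOp K ^ n) ≃ₗ[K] V :=
    LinearEquiv.ofFinrankEq _ _ (finrank_ker_derOp_pow K n)
  let g : I1 K := ⟨V.subtype ∘ₗ e.toLinearMap ∘ₗ kerProj K n,
    mem_I1_of_divPow_eq_zero K (m := n) fun k hk => by simp [kerProj_divPow K hk]⟩
  let g' : I1 K := ⟨(LinearMap.ker (derOp K ^ n)).subtype ∘ₗ e.symm.toLinearMap ∘ₗ
      p.1.rangeRestrict, mem_I1_of_divPow_eq_zero K (m := m) fun k hk => by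
    have : p.1.rangeRestrict (divPow K k) = 0 := Subtype.ext (hm k hk)
    simp [this]⟩
  have hpV : ∀ v : V, p.1.rangeRestrict v = v := by
    rintro ⟨_, f, rfl⟩
    exact Subtype.ext (LinearMap.congr_fun (congrArg Subtype.val hpp) f)
  have hdi := derI_pow_mul_intI_pow K n
  have hgi : g * intI K ^ n = 0 := Subtype.ext <| LinearMap.ext fun f => by
    change ((e (kerProj K n ((intOp K ^ n) f)) : V) : Polynomial K) = 0
    rw [kerProj_intOp_pow, map_zero, Submodule.coe_zero]
  have hdg : derI K ^ n * g' = 0 := Subtype.ext <| LinearMap.ext fun f =>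
    LinearMap.mem_ker.1 (e.symm (p.1.rangeRestrict f)).2
  have hcg : c * g = 0 := Subtype.ext <| LinearMap.ext fun f => by
    change c.1 (e (kerProj K n f)).1 = 0
    obtain ⟨y, hy⟩ := (e (kerProj K n f)).2
    rw [← hy]
    exact LinearMap.congr_fun (congrArg Subtype.val hcp) y
  have hga : g' * a = 0 := Subtype.ext <| LinearMap.ext fun f => by
    change ((e.symm (p.1.rangeRestrict (a.1 f)) : LinearMap.ker (derOp K ^ n)) : Polynomial K) = 0
    have : p.1.rangeRestrict (a.1 f) = 0 :=
      Subtype.ext (LinearMap.congr_fun (congrArg Subtype.val hpa) f)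
    rw [this, map_zero, Submodule.coe_zero]
  have hgg' : g * g' = p := Subtype.ext <| LinearMap.ext fun f => by
    change ((e (kerProj K n (e.symm (p.1.rangeRestrict f))) : V) : Polynomial K) = p.1 f
    rw [kerProj_coe, e.apply_symm_apply]
    rfl
  have hg'g : g' * g = 1 - intI K ^ n * derI K ^ n := Subtype.ext <| LinearMap.ext fun f => by
    change ((e.symm (p.1.rangeRestrict (e (kerProj K n f))) : LinearMap.ker (derOp K ^ n)) :
      Polynomial K) = _
    rw [hpV, e.symm_apply_apply]
    rfl
  refine ⟨⟨a * derI K ^ n + g, intI K ^ n * c + g', ?_, ?_⟩, n, ?_⟩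
  · calc (a * derI K ^ n + g) * (intI K ^ n * c + g')
        = a * (derI K ^ n * intI K ^ n) * c + a * (derI K ^ n * g') + (g * intI K ^ n) * c
          + g * g' := by noncomm_ring
      _ = 1 := by rw [hdi, hdg, hgi, hgg', hp]; noncomm_ring
  · calc (intI K ^ n * c + g') * (a * derI K ^ n + g)
        = intI K ^ n * (c * a) * derI K ^ n + intI K ^ n * (c * g) + (g' * a) * derI K ^ n
          + g' * g := by noncomm_ring
      _ = 1 := by rw [h, hcg, hga, hg'g]; noncomm_ring
  · change a = (a * derI K ^ n + g) * intI K ^ n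
    rw [add_mul, mul_assoc, hdi, hgi, mul_one, add_zero]

lemma exists_derI_pow_mul_unit {b c : I1 K} (h : b * c = 1) :
    ∃ (u : (I1 K)ˣ) (n : ℕ), b = derI K ^ n * ↑u := by
  obtain ⟨u, n, rfl⟩ := exists_unit_mul_intI_pow h
  obtain ⟨w, hw⟩ := exists_eq_mul_unit (R := I1 K) u h (derI_pow_mul_intI_pow K n)
  exact ⟨w, n, hw⟩

lemma finrank_coker_unit_mul_intI_pow (u : (I1 K)ˣ) (n : ℕ) :
    Module.finrank K (Polynomial K ⧸
      LinearMap.range ((↑u * intI K ^ n : I1 K) : Module.End K (Polynomial K))) = n := by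
  have huv : ∀ f, u.val.1 (u.inv.1 f) = f := fun f =>
    LinearMap.congr_fun (congrArg Subtype.val u.val_inv) f
  have hvu : ∀ f, u.inv.1 (u.val.1 f) = f := fun f =>
    LinearMap.congr_fun (congrArg Subtype.val u.inv_val) f
  have hker : LinearMap.range ((↑u * intI K ^ n : I1 K) : Module.End K (Polynomial K)) =
      LinearMap.ker (kerProj K n ∘ₗ u.inv.1) := by
    ext f
    constructor
    · rintro ⟨y, rfl⟩
      change kerProj K n (u.inv.1 (u.val.1 ((intOp K ^ n) y))) = 0
      rw [hvu, kerProj_intOp_pow]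
    · intro hf
      have hf' := congrArg Subtype.val (LinearMap.mem_ker.1 hf)
      rw [LinearMap.comp_apply, coe_kerProj, Submodule.coe_zero, sub_eq_zero] at hf'
      refine ⟨(derOp K ^ n) (u.inv.1 f), ?_⟩
      change u.val.1 ((intOp K ^ n) ((derOp K ^ n) (u.inv.1 f))) = f
      rw [← hf', huv]
  have hsurj : Function.Surjective (kerProj K n ∘ₗ u.inv.1) := fun w =>
    ⟨u.val.1 w, by rw [LinearMap.comp_apply, hvu, kerProj_coe]⟩
  rw [hker, (LinearMap.quotKerEquivOfSurjective _ hsurj).finrank_eq, finrank_ker_derOp_pow]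

lemma finrank_ker_derI_pow_mul_unit (u : (I1 K)ˣ) (n : ℕ) :
    Module.finrank K
      (LinearMap.ker ((derI K ^ n * ↑u : I1 K) : Module.End K (Polynomial K))) = n := by
  let U : Polynomial K ≃ₗ[K] Polynomial K := LinearEquiv.ofLinearMap u.val.1 u.inv.1
    (congrArg Subtype.val u.val_inv) (congrArg Subtype.val u.inv_val)
  have hker : LinearMap.ker ((derI K ^ n * ↑u : I1 K) : Module.End K (Polynomial K)) =
      (LinearMap.ker (derOp K ^ n)).comap U.toLinearMap := rfl
  rw [hker, (U.submoduleMap _).finrank_eq,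
    Submodule.map_comap_eq_of_surjective U.surjective, finrank_ker_derOp_pow]

/-- `a ∈ I₁` has a left inverse iff `a = u ∫^n` for a unit `u` of `I₁` and
some `n ≥ 0`, and then `n = dim_K coker(a_{K[x]})`; dually, `b` has a right inverse iff
`b = ∂^n u` for a unit `u`, and then `n = dim_K ker(b_{K[x]})`. -/
theorem statement18 (a b : I1 K) :
    ((∃ c : I1 K, c * a = 1) ↔ ∃ (u : (I1 K)ˣ) (n : ℕ), a = ↑u * intI K ^ n)
    ∧ (∀ (u : (I1 K)ˣ) (n : ℕ), a = ↑u * intI K ^ n →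
        n = Module.finrank K
          (Polynomial K ⧸ LinearMap.range (a : Module.End K (Polynomial K))))
    ∧ ((∃ c : I1 K, b * c = 1) ↔ ∃ (u : (I1 K)ˣ) (n : ℕ), b = derI K ^ n * ↑u)
    ∧ (∀ (u : (I1 K)ˣ) (n : ℕ), b = derI K ^ n * ↑u →
        n = Module.finrank K ↥(LinearMap.ker (b : Module.End K (Polynomial K)))) := by
  refine ⟨⟨fun ⟨c, h⟩ => exists_unit_mul_intI_pow h, ?_⟩, ?_,
    ⟨fun ⟨c, h⟩ => exists_derI_pow_mul_unit h, ?_⟩, ?_⟩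
  · rintro ⟨u, n, rfl⟩
    refine ⟨derI K ^ n * ↑u⁻¹, ?_⟩
    rw [mul_assoc, Units.inv_mul_cancel_left, derI_pow_mul_intI_pow]
  · rintro u n rfl
    exact (finrank_coker_unit_mul_intI_pow u n).symm
  · rintro ⟨u, n, rfl⟩
    refine ⟨↑u⁻¹ * intI K ^ n, ?_⟩
    rw [mul_assoc, Units.mul_inv_cancel_left, derI_pow_mul_intI_pow]
  · rintro u n rfl
    exact (finrank_ker_derI_pow_mul_unit u n).symm

end
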